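/- Let n ≥ 2. The ideal u_{n,2} = P_1∂_2 ⊕ ⋯ ⊕ P_{n-1}∂_n is the largest proper ideal of the Lie algebra u_n (every ideal I ≠ u_n satisfies I ⊆ u_{n,2}); moreover u_{n,2} is the unique ideal I of u_n with I ≠ 0, I ≠ u_n and dim_K(u_n/I) < ∞, and dim_K(u_n/u_{n,2}) = 1. -/

import Mathlib

open MvPolynomial

noncomputable section


/-- If a derivation of `MvPolynomial σ K` maps every generator `X j`, `j ∈ s`, into the
subalgebra `supported K s` of polynomials supported on `s`, then it maps the whole of
`supported K s` into itself. -/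
theorem Derivation.mem_supported_of_forall_mem
    {K : Type*} [CommRing K] {σ : Type*} (s : Set σ)
    (D : Derivation K (MvPolynomial σ K) (MvPolynomial σ K))
    (h : ∀ j ∈ s, D (X j) ∈ supported K s)
    {p : MvPolynomial σ K} (hp : p ∈ supported K s) : D p ∈ supported K s := by
  rw [supported_eq_adjoin_X] at hp
  induction hp using Algebra.adjoin_induction with
  | mem x hx =>
    obtain ⟨j, hj, rfl⟩ := hx
    exact h j hj
  | algebraMap r =>
    rw [Derivation.map_algebraMap]
    exact zero_mem _
  | add x y hx hy ihx ihy =>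
    rw [map_add]
    exact add_mem ihx ihy
  | mul x y hx hy ihx ihy =>
    rw [Derivation.leibniz, smul_eq_mul, smul_eq_mul]
    rw [← supported_eq_adjoin_X] at hx hy
    exact add_mem (mul_mem hx ihy) (mul_mem hy ihx)

/-- If a derivation of `MvPolynomial σ K` kills every generator `X j`, `j ∈ s`, then it
kills the whole subalgebra `supported K s`. -/
theorem Derivation.eq_zero_of_forall_eq_zero
    {K : Type*} [CommRing K] {σ : Type*} (s : Set σ)
    (D : Derivation K (MvPolynomial σ K) (MvPolynomial σ K))
    (h : ∀ j ∈ s, D (X j) = 0)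
    {p : MvPolynomial σ K} (hp : p ∈ supported K s) : D p = 0 := by
  rw [supported_eq_adjoin_X] at hp
  induction hp using Algebra.adjoin_induction with
  | mem x hx =>
    obtain ⟨j, hj, rfl⟩ := hx
    exact h j hj
  | algebraMap r =>
    rw [Derivation.map_algebraMap]
  | add x y hx hy ihx ihy =>
    rw [map_add, ihx, ihy, add_zero]
  | mul x y hx hy ihx ihy =>
    rw [Derivation.leibniz, ihx, ihy, smul_zero, smul_zero, add_zero]

/-- The defining condition for the Lie algebra `u_n = K∂₁ ⊕ P₁∂₂ ⊕ ⋯ ⊕ P_{n-1}∂ₙ` of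
triangular polynomial derivations of `P_n = K[x₁,…,xₙ]` (variables indexed by `Fin n`,
zero-based): a derivation `D` of `P_n` is triangular iff, for every `i`, the polynomial
`D (X i)` only involves the variables `X j` with `j < i` (so the coefficient of `∂_i`
lies in `P_{i-1}`, where `P₀ = K`). -/
def triSet (K : Type*) [Field K] (n : ℕ) :
    Set (Derivation K (MvPolynomial (Fin n) K) (MvPolynomial (Fin n) K)) :=
  {D | ∀ i : Fin n, D (X i) ∈ supported K {j : Fin n | (j : ℕ) < (i : ℕ)}}

theorem supported_upward {K : Type*} [Field K] {n : ℕ}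
    (p : MvPolynomial (Fin n) K) (s t : Set (Fin n)) (hst : s ⊆ t)
    (hp : p ∈ supported K s) : p ∈ supported K t :=
  supported_mono hst hp

theorem triSet_stable {K : Type*} [Field K] {n : ℕ}
    {D : Derivation K (MvPolynomial (Fin n) K) (MvPolynomial (Fin n) K)}
    (hD : D ∈ triSet K n) (i : Fin n) :
    ∀ j ∈ {j' : Fin n | (j' : ℕ) < (i : ℕ)},
      D (X j) ∈ supported K {j' : Fin n | (j' : ℕ) < (i : ℕ)} := by
  intro j hj
  refine supported_upward _ {j' : Fin n | (j' : ℕ) < (j : ℕ)} _ ?_ (hD j)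
  intro l hl
  have hl' : (l : ℕ) < (j : ℕ) := hl
  have hj' : (j : ℕ) < (i : ℕ) := hj
  exact lt_trans hl' hj'

theorem triSet_lie {K : Type*} [Field K] {n : ℕ}
    {a b : Derivation K (MvPolynomial (Fin n) K) (MvPolynomial (Fin n) K)}
    (ha : a ∈ triSet K n) (hb : b ∈ triSet K n) : ⁅a, b⁆ ∈ triSet K n := by
  intro i
  rw [Derivation.commutator_apply]
  exact sub_mem
    (Derivation.mem_supported_of_forall_mem _ a (triSet_stable ha i) (hb i))
    (Derivation.mem_supported_of_forall_mem _ b (triSet_stable hb i) (ha i))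

/-- The Lie algebra `u_n = K∂₁ ⊕ P₁∂₂ ⊕ ⋯ ⊕ P_{n-1}∂ₙ` of triangular polynomial
derivations, as a Lie subalgebra of the Lie algebra of all `K`-derivations of the
polynomial algebra `P_n = K[x₁,…,xₙ]`. -/
def triangular (K : Type*) [Field K] (n : ℕ) :
    LieSubalgebra K (Derivation K (MvPolynomial (Fin n) K) (MvPolynomial (Fin n) K)) where
  carrier := triSet K n
  add_mem' := fun {a b} ha hb i => by
    rw [Derivation.add_apply]; exact add_mem (ha i) (hb i)
  zero_mem' := fun i => by
    rw [Derivation.zero_apply]; exact zero_mem _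
  smul_mem' := fun c a ha i => by
    rw [Derivation.smul_apply]; exact Subalgebra.smul_mem _ (ha i) c
  lie_mem' := fun {a b} ha hb => triSet_lie ha hb

theorem mem_triangular_iff {K : Type*} [Field K] {n : ℕ}
    (D : Derivation K (MvPolynomial (Fin n) K) (MvPolynomial (Fin n) K)) :
    D ∈ triangular K n ↔
      ∀ i : Fin n, D (X i) ∈ supported K {j : Fin n | (j : ℕ) < (i : ℕ)} := Iff.rfl

/-- The subspace `u_{n,k+1} = ⊕_{j ≥ k+1} P_{j-1}∂_j` of `u_n` (1-based indexing as in the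
paper): the triangular derivations whose coefficients at `∂₁, …, ∂_k` vanish, i.e.
(zero-based) `D (X j) = 0` for all `j < k`. -/
def lowIdeal (K : Type*) [Field K] (n k : ℕ) : Submodule K ↥(triangular K n) where
  carrier := {a | ∀ j : Fin n, (j : ℕ) < k → a.val (X j) = 0}
  add_mem' := by
    intro a b ha hb j hj
    have hab : (a + b : ↥(triangular K n)).val = a.val + b.val := rfl
    rw [hab, Derivation.add_apply, ha j hj, hb j hj, add_zero]
  zero_mem' := by
    intro j hj
    have h0 : (0 : ↥(triangular K n)).val = 0 := rfl
    rw [h0, Derivation.zero_apply]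
  smul_mem' := by
    intro c a ha j hj
    have hca : (c • a : ↥(triangular K n)).val = c • a.val := rfl
    rw [hca, Derivation.smul_apply, ha j hj, smul_zero]

theorem tri_iter_mul {K A : Type*} [Field K] [CommRing A] [Algebra K A] (D : Derivation K A A) :
    ∀ (m N M : ℕ) (p q : A), N + M = m → (D^[N]) p = 0 → (D^[M]) q = 0 → (D^[m]) (p * q) = 0 := by
  have h0 : ∀ m, (D^[m]) 0 = 0 := fun m => iterate_map_zero D m
  intro m
  induction m with
  | zero =>
    intro N M p q h hp hq
    obtain rfl : N = 0 := by omega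
    have hp' : p = 0 := hp
    simp [hp']
  | succ m ih =>
    intro N M p q h hp hq
    rcases N with _ | N
    · have hp' : p = 0 := hp
      rw [hp', zero_mul, h0]
    rcases M with _ | M
    · have hq' : q = 0 := hq
      rw [hq', mul_zero, h0]
    rw [Function.iterate_succ_apply, Derivation.leibniz, iterate_map_add, smul_eq_mul, smul_eq_mul,
      ih (N + 1) M p (D q) (by omega) hp (by rwa [Function.iterate_succ_apply] at hq),
      ih (M + 1) N q (D p) (by omega) hq (by rwa [Function.iterate_succ_apply] at hp), add_zero]

theorem tri_iter_le {K A : Type*} [Field K] [CommRing A] [Algebra K A] (D : Derivation K A A)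
    {N M : ℕ} (h : N ≤ M) {p : A} (hp : (D^[N]) p = 0) : (D^[M]) p = 0 := by
  obtain ⟨k, rfl⟩ := Nat.exists_eq_add_of_le' h
  rw [Function.iterate_add_apply, hp, iterate_map_zero]

theorem tri_nil_supported {K : Type*} [Field K] {σ : Type*} (s : Set σ)
    (D : Derivation K (MvPolynomial σ K) (MvPolynomial σ K))
    (h : ∀ j ∈ s, ∃ N, (D^[N]) (X j) = 0)
    {p : MvPolynomial σ K} (hp : p ∈ supported K s) : ∃ N, (D^[N]) p = 0 := by
  rw [supported_eq_adjoin_X] at hp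
  induction hp using Algebra.adjoin_induction with
  | mem x hx =>
    obtain ⟨j, hj, rfl⟩ := hx
    exact h j hj
  | algebraMap r =>
    exact ⟨1, by rw [Function.iterate_one, Derivation.map_algebraMap]⟩
  | add x y hx hy ihx ihy =>
    obtain ⟨N, hN⟩ := ihx
    obtain ⟨M, hM⟩ := ihy
    refine ⟨max N M, ?_⟩
    rw [iterate_map_add, tri_iter_le D (le_max_left _ _) hN, tri_iter_le D (le_max_right _ _) hM,
      add_zero]
  | mul x y hx hy ihx ihy =>
    obtain ⟨N, hN⟩ := ihx
    obtain ⟨M, hM⟩ := ihy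
    exact ⟨N + M, tri_iter_mul D _ N M x y rfl hN hM⟩

theorem tri_nil {K : Type*} [Field K] {n : ℕ}
    {D : Derivation K (MvPolynomial (Fin n) K) (MvPolynomial (Fin n) K)}
    (hD : D ∈ triSet K n) (p : MvPolynomial (Fin n) K) : ∃ N, (D^[N]) p = 0 := by
  have hX : ∀ (m : ℕ) (i : Fin n), (i : ℕ) = m → ∃ N, (D^[N]) (X i) = 0 := by
    intro m
    induction m using Nat.strong_induction_on with
    | _ m ih =>
      intro i hi
      obtain ⟨N, hN⟩ := tri_nil_supported {j : Fin n | (j : ℕ) < (i : ℕ)} D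
        (fun j hj => ih j (by have : (j : ℕ) < i := hj
                              omega) j rfl) (hD i)
      exact ⟨N + 1, by rwa [Function.iterate_succ_apply]⟩
  exact tri_nil_supported Set.univ D (fun j _ => hX j j rfl) (by simp [supported_univ])

theorem tri_slice {K A : Type*} [Field K] [CharZero K] [CommRing A] [Algebra K A]
    (D : Derivation K A A) (S : Subalgebra K A) (hS : ∀ p ∈ S, D p ∈ S) (x : A) (hx : x ∈ S)
    (hDx : D x = 1) : ∀ (N k : ℕ) (p : A), p ∈ S → (D^[N]) p = 0 →
      ∃ q ∈ S, D q = x ^ k * p := by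
  intro N
  induction N with
  | zero =>
    intro k p _ h
    have h' : p = 0 := h
    exact ⟨0, zero_mem _, by simp [h']⟩
  | succ N ih =>
    intro k p hp h
    rw [Function.iterate_succ_apply] at h
    obtain ⟨q, hq, hDq⟩ := ih (k + 1) (D p) (hS p hp) h
    have hk : ((k : K) + 1) ≠ 0 := by exact_mod_cast Nat.succ_ne_zero k
    refine ⟨((k : K) + 1)⁻¹ • (x ^ (k + 1) * p - q),
      S.smul_mem (sub_mem (mul_mem (pow_mem hx _) hp) hq) _, ?_⟩
    rw [Derivation.map_smul, inv_smul_eq_iff₀ hk, map_sub, hDq, Derivation.leibniz,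
      Derivation.leibniz_pow, hDx, Algebra.smul_def ((k : K) + 1), map_add, map_natCast, map_one,
      Nat.add_sub_cancel]
    simp only [smul_eq_mul, nsmul_eq_mul, Nat.cast_add, Nat.cast_one]
    ring

theorem tri_surj {K : Type*} [Field K] [CharZero K] {n : ℕ} (hn : 0 < n)
    {D : Derivation K (MvPolynomial (Fin n) K) (MvPolynomial (Fin n) K)}
    (hD : D ∈ triSet K n) (c : K) (hc : c ≠ 0) (hDc : D (X ⟨0, hn⟩) = C c)
    (i : Fin n) (hi : 0 < (i : ℕ)) (p : MvPolynomial (Fin n) K)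
    (hp : p ∈ supported K {j : Fin n | (j : ℕ) < (i : ℕ)}) :
    ∃ q ∈ supported K {j : Fin n | (j : ℕ) < (i : ℕ)}, D q = p := by
  obtain ⟨N, hN⟩ := tri_nil hD p
  have hx : (X ⟨0, hn⟩ : MvPolynomial (Fin n) K) ∈ supported K {j : Fin n | (j : ℕ) < (i : ℕ)} :=
    (X_mem_supported (R := K)).mpr (Set.mem_setOf_eq ▸ hi)
  have hx' : (C c⁻¹ * X ⟨0, hn⟩ : MvPolynomial (Fin n) K) ∈
      supported K {j : Fin n | (j : ℕ) < (i : ℕ)} :=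
    mul_mem (Subalgebra.algebraMap_mem _ _) hx
  have hDx : D (C c⁻¹ * X ⟨0, hn⟩) = 1 := by
    rw [Derivation.leibniz, hDc, derivation_C, smul_zero, add_zero, smul_eq_mul, ← C_mul,
      inv_mul_cancel₀ hc, C_1]
  obtain ⟨q, hq, h⟩ := tri_slice D (supported K {j : Fin n | (j : ℕ) < (i : ℕ)})
    (fun p hp => Derivation.mem_supported_of_forall_mem _ D (triSet_stable hD i) hp)
    _ hx' hDx N 0 p hp hN
  exact ⟨q, hq, by rw [h, pow_zero, one_mul]⟩

theorem tri_zero_const {K : Type*} [Field K] {n : ℕ} (hn : 0 < n)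
    {D : Derivation K (MvPolynomial (Fin n) K) (MvPolynomial (Fin n) K)}
    (hD : D ∈ triSet K n) : D (X ⟨0, hn⟩) = C (constantCoeff (D (X ⟨0, hn⟩))) := by
  have h := hD ⟨0, hn⟩
  have he : {j : Fin n | (j : ℕ) < ((⟨0, hn⟩ : Fin n) : ℕ)} = ∅ := by ext; simp
  rw [he, supported_empty, Algebra.mem_bot] at h
  obtain ⟨r, hr⟩ := h
  rw [← hr, algebraMap_eq, constantCoeff_C]

theorem tri_step {K : Type*} [Field K] [CharZero K] {n : ℕ} (hn : 0 < n)
    (I : LieIdeal K ↥(triangular K n)) (a : ↥(triangular K n)) (ha : a ∈ I)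
    (c : K) (hc : c ≠ 0) (hac : a.val (X ⟨0, hn⟩) = C c) :
    ∀ (m k : ℕ), 0 < k → k + m = n → ∀ b ∈ lowIdeal K n k, b ∈ I := by
  intro m
  induction m with
  | zero =>
    intro k hk hkn b hb
    have : b = 0 := by
      apply Subtype.ext
      apply MvPolynomial.derivation_ext
      intro i
      exact hb i (by omega)
    rw [this]
    exact zero_mem _
  | succ m ih =>
    intro k hk hkn b hb
    have hkn' : k < n := by omega
    obtain ⟨q, hq, haq⟩ := tri_surj hn a.property c hc hac ⟨k, hkn'⟩ hk _ (b.property ⟨k, hkn'⟩)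
    let d' := mkDerivation K (fun i : Fin n => if i = ⟨k, hkn'⟩ then q else 0)
    have hd'X : ∀ i, d' (X i) = if i = ⟨k, hkn'⟩ then q else 0 := fun i => mkDerivation_X _ _ _
    have hd' : d' ∈ triangular K n := by
      intro i
      rw [hd'X]
      split_ifs with h
      · rw [h]; exact hq
      · exact zero_mem _
    let d : ↥(triangular K n) := ⟨d', hd'⟩
    have h1 : ⁅a, d⁆ ∈ I := lie_mem_left K _ I a d ha
    have hzero : ∀ j : Fin n, (j : ℕ) ≤ k → d' (a.val (X j)) = 0 := by
      intro j hj
      refine Derivation.eq_zero_of_forall_eq_zero _ d' ?_ (a.property j)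
      intro l hl
      have hl' : (l : ℕ) < j := hl
      rw [hd'X, if_neg]
      rintro rfl
      simp at hl'
      omega
    have h2 : b - ⁅a, d⁆ ∈ lowIdeal K n (k + 1) := by
      intro j hj
      have e : (b - ⁅a, d⁆ : ↥(triangular K n)).val (X j)
          = b.val (X j) - (a.val (d' (X j)) - d' (a.val (X j))) := by
        rw [← Derivation.commutator_apply]; rfl
      rw [e, hzero j (by omega), hd'X]
      split_ifs with h
      · rw [h, haq]; simp
      · rw [hb j (by
          have : (j : ℕ) ≠ k := fun h' => h (Fin.ext h')
          omega)]
        simp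
    have h3 := ih (k + 1) (by omega) (by omega) _ h2
    have := add_mem h3 h1
    rwa [sub_add_cancel] at this

theorem tri_part1 {K : Type*} [Field K] [CharZero K] {n : ℕ} (hn : 2 ≤ n)
    (I : LieIdeal K ↥(triangular K n)) (hI : I ≠ ⊤) (a : ↥(triangular K n)) (ha : a ∈ I) :
    a ∈ lowIdeal K n 1 := by
  have hn0 : 0 < n := by omega
  by_contra hna
  apply hI
  have hac := tri_zero_const hn0 a.property
  set c := constantCoeff (a.val (X ⟨0, hn0⟩)) with hcdef
  have hc : c ≠ 0 := by
    intro h0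
    apply hna
    intro j hj
    obtain rfl : j = ⟨0, hn0⟩ := Fin.ext (by simpa using hj)
    rw [hac, h0, C_0]
  have hlow := tri_step hn0 I a ha c hc hac (n - 1) 1 one_pos (by omega)
  rw [eq_top_iff]
  intro b _
  have hbc := tri_zero_const hn0 b.property
  set e := constantCoeff (b.val (X ⟨0, hn0⟩)) with hedef
  have h2 : b - (e * c⁻¹) • a ∈ lowIdeal K n 1 := by
    intro j hj
    obtain rfl : j = ⟨0, hn0⟩ := Fin.ext (by simpa using hj)
    have : (b - (e * c⁻¹) • a : ↥(triangular K n)).val (X ⟨0, hn0⟩)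
      = b.val (X ⟨0, hn0⟩) - (e * c⁻¹) • a.val (X ⟨0, hn0⟩) := rfl
    rw [this, hac, hbc, smul_eq_C_mul, ← C_mul, inv_mul_cancel_right₀ hc, sub_self]
  have h4 : (e * c⁻¹) • a ∈ I := I.toSubmodule.smul_mem _ ha
  have := add_mem (hlow _ h2) h4
  rwa [sub_add_cancel] at this

theorem tri_part2 {K : Type*} [Field K] [CharZero K] {n : ℕ} (hn : 2 ≤ n)
    (I : LieIdeal K ↥(triangular K n)) (hI : ∀ a ∈ I, a ∈ lowIdeal K n 1)
    (hfd : FiniteDimensional K (↥(triangular K n) ⧸ I.toSubmodule))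
    (b : ↥(triangular K n)) (hb : b ∈ lowIdeal K n 1) : b ∈ I := by
  have hn0 : 0 < n := by omega
  let D' : Derivation K (MvPolynomial (Fin n) K) (MvPolynomial (Fin n) K) := pderiv ⟨0, hn0⟩
  have hD'X : ∀ i : Fin n, ∃ r : K, D' (X i) = C r := by
    intro i
    refine ⟨if i = ⟨0, hn0⟩ then 1 else 0, ?_⟩
    split_ifs with h
    · rw [h]; simp [D']
    · rw [C_0]; exact pderiv_X_of_ne h
  have hD' : D' ∈ triangular K n := by
    intro i
    obtain ⟨r, hr⟩ := hD'X i
    rw [hr]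
    exact Subalgebra.algebraMap_mem _ r
  let D : ↥(triangular K n) := ⟨D', hD'⟩
  have hlie : ∀ (d : ↥(triangular K n)) (i : Fin n), (⁅D, d⁆ : ↥(triangular K n)).val (X i)
      = D' (d.val (X i)) := by
    intro d i
    have e : (⁅D, d⁆ : ↥(triangular K n)).val (X i)
        = D' (d.val (X i)) - d.val (D' (X i)) := Derivation.commutator_apply _
    obtain ⟨r, hr⟩ := hD'X i
    rw [e, hr, derivation_C, sub_zero]
  let T : ↥(triangular K n) →ₗ[K] ↥(triangular K n) := (LieAlgebra.ad K ↥(triangular K n) D)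
  have hT : ∀ d, T d = ⁅D, d⁆ := fun d => rfl
  have hTlow : ∀ d ∈ lowIdeal K n 1, T d ∈ lowIdeal K n 1 := by
    intro d hd j hj
    rw [hT, hlie, hd j hj, map_zero]
  have hTI : I.toSubmodule ≤ I.toSubmodule.comap T := by
    intro d hd
    exact lie_mem_right K _ I D d hd
  let π := I.toSubmodule.mkQ
  let V := (lowIdeal K n 1).map π
  let Tq := I.toSubmodule.mapQ I.toSubmodule T hTI
  have hTq : ∀ v ∈ V, Tq v ∈ V := by
    rintro _ ⟨d, hd, rfl⟩
    exact ⟨T d, hTlow d hd, rfl⟩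
  let R : V →ₗ[K] V := Tq.restrict hTq
  have hsurj : Function.Surjective R := by
    rintro ⟨_, d, hd, rfl⟩
    have hex : ∀ i : Fin n, ∃ q ∈ supported K {j : Fin n | (j : ℕ) < (i : ℕ)},
        D' q = d.val (X i) ∧ ((i : ℕ) < 1 → q = 0) := by
      intro i
      by_cases hi : (i : ℕ) < 1
      · exact ⟨0, zero_mem _, by rw [hd i hi, map_zero], fun _ => rfl⟩
      · obtain ⟨q, hq, h⟩ := tri_surj hn0 hD' 1 one_ne_zero (by simp [D']) i (by omega) _
          (d.property i)
        exact ⟨q, hq, h, fun h => absurd h hi⟩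
    choose q hq hDq hq0 using hex
    have hf : mkDerivation K q ∈ triangular K n := by
      intro i
      rw [mkDerivation_X]
      exact hq i
    let f : ↥(triangular K n) := ⟨mkDerivation K q, hf⟩
    have hfX : ∀ i, f.val (X i) = q i := fun i => mkDerivation_X _ _ _
    have hflow : f ∈ lowIdeal K n 1 := by
      intro j hj
      rw [hfX, hq0 j hj]
    refine ⟨⟨π f, f, hflow, rfl⟩, ?_⟩
    apply Subtype.ext
    change π (T f) = π d
    congr 1
    apply Subtype.ext
    apply MvPolynomial.derivation_ext
    intro i
    rw [hT, hlie, hfX, hDq]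
  have hVfd : FiniteDimensional K V :=
    @FiniteDimensional.finiteDimensional_submodule K _ _ _ _ hfd V
  have hinj : Function.Injective R := LinearMap.injective_iff_surjective.mpr hsurj
  have hiter : ∀ (m : ℕ) (i : Fin n), ((T^[m]) b).val (X i) = (D'^[m]) (b.val (X i)) := by
    intro m i
    induction m with
    | zero => rfl
    | succ m ih => rw [Function.iterate_succ_apply', hT, hlie, ih, Function.iterate_succ_apply']
  have hN : ∃ N, (T^[N]) b = 0 := by
    choose N hN using fun i : Fin n => tri_nil hD' (b.val (X i))
    refine ⟨Finset.univ.sup N, ?_⟩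
    apply Subtype.ext
    apply MvPolynomial.derivation_ext
    intro i
    rw [hiter]
    exact tri_iter_le D' (Finset.le_sup (Finset.mem_univ i)) (hN i)
  obtain ⟨N, hN⟩ := hN
  have hR : ∀ (m : ℕ), ((R^[m]) ⟨π b, b, hb, rfl⟩).val = π ((T^[m]) b) := by
    intro m
    induction m with
    | zero => rfl
    | succ m ih =>
      rw [Function.iterate_succ_apply', Function.iterate_succ_apply']
      change Tq ((R^[m]) ⟨π b, b, hb, rfl⟩).val = _
      rw [ih]
      rfl
  have hz : (⟨π b, b, hb, rfl⟩ : V) = 0 := by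
    apply hinj.iterate N
    rw [iterate_map_zero]
    apply Subtype.ext
    rw [hR, hN, map_zero]
    rfl
  have hz' : π b = 0 := congrArg Subtype.val hz
  exact (Submodule.Quotient.mk_eq_zero _).mp hz'

theorem tri_part3 {K : Type*} [Field K] {n : ℕ} (hn : 2 ≤ n) :
    Module.finrank K (↥(triangular K n) ⧸ lowIdeal K n 1) = 1 := by
  have hn0 : 0 < n := by omega
  let φ : ↥(triangular K n) →ₗ[K] K :=
    { toFun := fun a => constantCoeff (a.val (X ⟨0, hn0⟩))
      map_add' := fun a b => by
        change constantCoeff (a.val (X ⟨0, hn0⟩) + b.val (X ⟨0, hn0⟩)) = _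
        rw [map_add]
      map_smul' := fun c a => by
        change constantCoeff (c • a.val (X ⟨0, hn0⟩)) = _
        rw [constantCoeff_smul]
        rfl }
  have hker : LinearMap.ker φ = lowIdeal K n 1 := by
    ext a
    rw [LinearMap.mem_ker]
    constructor
    · intro h j hj
      obtain rfl : j = ⟨0, hn0⟩ := Fin.ext (by simpa using hj)
      rw [tri_zero_const hn0 a.property]
      have h' : constantCoeff (a.val (X ⟨0, hn0⟩)) = 0 := h
      rw [h', C_0]
    · intro h
      change constantCoeff (a.val (X ⟨0, hn0⟩)) = 0
      rw [h ⟨0, hn0⟩ (by simp), map_zero]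
  have hsurj : Function.Surjective φ := by
    intro c
    have hf : mkDerivation K (fun _ : Fin n => (C c : MvPolynomial (Fin n) K)) ∈
        triangular K n := by
      intro i
      rw [mkDerivation_X]
      exact Subalgebra.algebraMap_mem _ c
    have e : mkDerivation K (fun _ : Fin n => (C c : MvPolynomial (Fin n) K)) (X ⟨0, hn0⟩)
        = C c := mkDerivation_X _ _ _
    refine ⟨⟨_, hf⟩, ?_⟩
    exact (congrArg constantCoeff e).trans (constantCoeff_C _ c)
  rw [← hker, (φ.quotKerEquivOfSurjective hsurj).finrank_eq, Module.finrank_self]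

/-- For `n ≥ 2`, the ideal `u_{n,2} = P₁∂₂ ⊕ ⋯ ⊕ P_{n-1}∂ₙ` (the set of
triangular derivations whose coefficient at `∂₁` vanishes, `lowIdeal K n 1`) is the
largest proper ideal of `u_n`; it is the unique ideal `I` with `I ≠ 0`, `I ≠ u_n` and
`dim_K(u_n/I) < ∞`; and `dim_K(u_n/u_{n,2}) = 1`. -/
theorem triangular_largest_proper_ideal
    (K : Type*) [Field K] [CharZero K] (n : ℕ) (hn : 2 ≤ n) :
    (∀ I : LieIdeal K ↥(triangular K n), I ≠ ⊤ → ∀ a ∈ I, a ∈ lowIdeal K n 1) ∧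
    (∀ I : LieIdeal K ↥(triangular K n), I ≠ ⊥ → I ≠ ⊤ →
      FiniteDimensional K (↥(triangular K n) ⧸ I.toSubmodule) →
      ∀ a : ↥(triangular K n), a ∈ I ↔ a ∈ lowIdeal K n 1) ∧
    Module.finrank K (↥(triangular K n) ⧸ lowIdeal K n 1) = 1 := by
  refine ⟨tri_part1 hn, ?_, tri_part3 hn⟩
  intro I _ hI hfd a
  exact ⟨tri_part1 hn I hI a, tri_part2 hn I (tri_part1 hn I hI) hfd a⟩
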